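/- Let f : ℝ^d → ℝ^p be differentiable with ‖∇_x f(x)‖_F ≤ L for all x ∈ ℝ^d, let Q be a probability distribution on ℝ^d, and let D = (x_1, …, x_m) be drawn i.i.d. from Q with m ≥ 1. Then for every δ > 0, with probability at least 1 − δ/2 over the draw of D, the geometric complexity is bounded by the empirical geometric complexity: GC(f, Q) ≤ ĜC(f, D) + L² · √(log(2/δ) / (2m)). -/

import Mathlib

open MeasureTheory ENNReal

/-- Squared Frobenius norm of the Jacobian of `f` at `x`: the sum over output
coordinates of the squared Euclidean norms of the coordinate gradients. -/
noncomputable def frobSq {d p : ℕ}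
    (f : EuclideanSpace ℝ (Fin d) → EuclideanSpace ℝ (Fin p))
    (x : EuclideanSpace ℝ (Fin d)) : ℝ :=
  ∑ j : Fin p, ‖gradient (fun y => f y j) x‖ ^ 2

/-- Geometric complexity of `f` with respect to the distribution `Q`. -/
noncomputable def GC {d p : ℕ}
    (f : EuclideanSpace ℝ (Fin d) → EuclideanSpace ℝ (Fin p))
    (Q : Measure (EuclideanSpace ℝ (Fin d))) : ℝ :=
  ∫ x, frobSq f x ∂Q

/-- Class mean of `f` under `Q`. -/
noncomputable def classMean {d p : ℕ}
    (f : EuclideanSpace ℝ (Fin d) → EuclideanSpace ℝ (Fin p))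
    (Q : Measure (EuclideanSpace ℝ (Fin d))) : EuclideanSpace ℝ (Fin p) :=
  ∫ x, f x ∂Q

/-- Class variance of `f` under `Q`. -/
noncomputable def classVar {d p : ℕ}
    (f : EuclideanSpace ℝ (Fin d) → EuclideanSpace ℝ (Fin p))
    (Q : Measure (EuclideanSpace ℝ (Fin d))) : ℝ :=
  ∫ x, ‖f x - classMean f Q‖ ^ 2 ∂Q

/-- Class-distance normalized variance of two distributions. -/
noncomputable def CDNV {d p : ℕ}
    (f : EuclideanSpace ℝ (Fin d) → EuclideanSpace ℝ (Fin p))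
    (Qi Qj : Measure (EuclideanSpace ℝ (Fin d))) : ℝ :=
  (classVar f Qi + classVar f Qj) / (2 * ‖classMean f Qi - classMean f Qj‖ ^ 2)

/-- `P` satisfies a Poincaré inequality with constant `c`: for every differentiable
scalar function `v`, `Var_v(P) ≤ c · E_P[‖∇ v‖²]`. -/
def SatisfiesPoincare {d : ℕ} (c : ℝ) (P : Measure (EuclideanSpace ℝ (Fin d))) : Prop :=
  ∀ v : EuclideanSpace ℝ (Fin d) → ℝ, Differentiable ℝ v →
    ∫ x, (v x - ∫ y, v y ∂P) ^ 2 ∂P ≤ c * ∫ x, ‖gradient v x‖ ^ 2 ∂P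

/-- Empirical geometric complexity of `f` over the sample `D`. -/
noncomputable def empGC {d p m : ℕ}
    (f : EuclideanSpace ℝ (Fin d) → EuclideanSpace ℝ (Fin p))
    (D : Fin m → EuclideanSpace ℝ (Fin d)) : ℝ :=
  (1 / m : ℝ) * ∑ i : Fin m, frobSq f (D i)

open ProbabilityTheory in
/-- **Hoeffding's inequality** for i.i.d. samples, in one-sided confidence form: the mean of a
function with values in `[0, b]` exceeds its empirical mean by at most `b √(log (1/η) / (2m))`,
outside an event of probability at most `η`. -/
theorem measureReal_pi_empirical_mean_add_lt_integral_le {Ω : Type*} [MeasurableSpace Ω] {m : ℕ}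
    (hm : 1 ≤ m) (Q : Measure Ω) [IsProbabilityMeasure Q] {g : Ω → ℝ} (hg : Measurable g)
    {b : ℝ} (hb : ∀ x, g x ∈ Set.Icc 0 b) {η : ℝ} (hη : 0 < η) (hη1 : η ≤ 1) :
    (Measure.pi fun _ : Fin m => Q).real
      {D | (1 / m : ℝ) * ∑ i, g (D i) + b * √(Real.log (1 / η) / (2 * m)) < ∫ x, g x ∂Q} ≤ η := by
  have hm0 : (0 : ℝ) < m := by exact_mod_cast hm
  obtain ⟨x₀⟩ := Q.nonempty_of_neZero
  have hb0 : 0 ≤ b := (hb x₀).1.trans (hb x₀).2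
  have hlog : 0 ≤ Real.log (1 / η) := Real.log_nonneg ((one_le_div hη).2 hη1)
  rcases hb0.eq_or_lt with rfl | hbpos
  · have hg0 : ∀ x, g x = 0 := fun x => le_antisymm (hb x).2 (hb x).1
    simp [hg0, hη.le]
  set ε : ℝ := m * (b * √(Real.log (1 / η) / (2 * m))) with hε
  have hsub : HasSubgaussianMGF (fun x => (∫ y, g y ∂Q) - g x) ((‖b - 0‖₊ / 2) ^ 2) Q :=
    (hasSubgaussianMGF_of_mem_Icc hg.aemeasurable (ae_of_all _ hb)).neg.congr
      (ae_of_all _ fun x => by simp)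
  have hind : iIndepFun (fun (i : Fin m) (D : Fin m → Ω) => (∫ y, g y ∂Q) - g (D i))
      (Measure.pi fun _ : Fin m => Q) :=
    iIndepFun_pi (X := fun _ x => (∫ y, g y ∂Q) - g x)
      fun _ => (measurable_const.sub hg).aemeasurable
  have hsub' (i : Fin m) : HasSubgaussianMGF (fun D : Fin m → Ω => (∫ y, g y ∂Q) - g (D i))
      ((‖b - 0‖₊ / 2) ^ 2) (Measure.pi fun _ : Fin m => Q) := by
    have hmp := measurePreserving_eval (fun _ : Fin m => Q) i
    exact HasSubgaussianMGF.of_map (Y := Function.eval i)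
      (X := fun x => (∫ y, g y ∂Q) - g x) hmp.measurable.aemeasurable (by rwa [hmp.map_eq])
  have htail := HasSubgaussianMGF.measure_sum_ge_le_of_iIndepFun hind (s := Finset.univ)
    (fun i _ => hsub' i) (ε := ε) (by positivity)
  refine (measureReal_mono fun D hD => ?_).trans (htail.trans_eq ?_)
  · simp only [Set.mem_ofPred_eq, Finset.sum_sub_distrib, Finset.sum_const, Finset.card_univ,
      Fintype.card_fin, nsmul_eq_mul] at hD ⊢
    have h := mul_lt_mul_of_pos_left hD hm0
    have hcancel : (m : ℝ) * (1 / m * ∑ i, g (D i)) = ∑ i, g (D i) := by field_simp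
    rw [mul_add, hcancel] at h
    linarith
  · have hexp : -ε ^ 2 / (2 * (m * (b / 2) ^ 2)) = -Real.log (1 / η) := by
      rw [hε, mul_pow, mul_pow, Real.sq_sqrt (by positivity)]
      field_simp
    simp only [sub_zero, Finset.sum_const, Finset.card_univ, Fintype.card_fin, nsmul_eq_mul,
      NNReal.coe_mul, NNReal.coe_natCast, NNReal.coe_pow, NNReal.coe_div, coe_nnnorm,
      NNReal.coe_ofNat, Real.norm_of_nonneg hb0]
    rw [hexp, one_div, Real.log_inv, neg_neg, Real.exp_log hη]

theorem frobSq_nonneg {d p : ℕ} (f : EuclideanSpace ℝ (Fin d) → EuclideanSpace ℝ (Fin p))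
    (x : EuclideanSpace ℝ (Fin d)) : 0 ≤ frobSq f x :=
  Finset.sum_nonneg fun _ _ => sq_nonneg _

theorem measurable_frobSq {d p : ℕ} (f : EuclideanSpace ℝ (Fin d) → EuclideanSpace ℝ (Fin p)) :
    Measurable (frobSq f) := by
  refine Finset.measurable_fun_sum _ fun j _ => ?_
  simp only [gradient, LinearIsometryEquiv.norm_map]
  exact (measurable_fderiv ℝ _).norm.pow_const 2

/-- With probability at least `1 − δ/2` over an i.i.d. sample `D`
of size `m`, `GC(f,Q) ≤ ĜC(f,D) + L²·√(log(2/δ)/(2m))`. -/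
theorem gc_le_empirical_gc_whp {d p m : ℕ} (hm : 1 ≤ m)
    (Q : Measure (EuclideanSpace ℝ (Fin d))) [IsProbabilityMeasure Q]
    (f : EuclideanSpace ℝ (Fin d) → EuclideanSpace ℝ (Fin p))
    (hf : Differentiable ℝ f)
    (L : ℝ) (hL : ∀ x, Real.sqrt (frobSq f x) ≤ L)
    (δ : ℝ) (hδ : 0 < δ) :
    ENNReal.ofReal (1 - δ / 2) ≤
      (Measure.pi fun _ : Fin m => Q)
        {D | GC f Q ≤ empGC f D +
          L ^ 2 * Real.sqrt (Real.log (2 / δ) / (2 * m))} := by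
  rcases le_or_gt 2 δ with h2 | h2
  · rw [ENNReal.ofReal_of_nonpos (by linarith)]
    exact zero_le
  have hb : ∀ x, frobSq f x ∈ Set.Icc 0 (L ^ 2) := fun x =>
    ⟨frobSq_nonneg f x, (Real.sqrt_le_left ((Real.sqrt_nonneg _).trans (hL x))).1 (hL x)⟩
  have hmeas := measurable_frobSq f
  have key := measureReal_pi_empirical_mean_add_lt_integral_le hm Q hmeas hb
    (half_pos hδ) (by linarith)
  rw [one_div_div] at key
  have hset : MeasurableSet {D : Fin m → EuclideanSpace ℝ (Fin d) |
      GC f Q ≤ empGC f D + L ^ 2 * √(Real.log (2 / δ) / (2 * m))} := by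
    refine measurableSet_le measurable_const (Measurable.add_const ?_ _)
    exact (Finset.measurable_fun_sum _ fun i _ => hmeas.comp (measurable_pi_apply i)).const_mul _
  refine ENNReal.ofReal_le_of_le_toReal ?_
  have hcompl := probReal_compl_eq_one_sub (μ := Measure.pi fun _ : Fin m => Q) hset
  simp only [Set.compl_ofPred, not_le] at hcompl
  change 1 - δ / 2 ≤ (Measure.pi fun _ : Fin m => Q).real _
  change (Measure.pi fun _ : Fin m => Q).real {D | empGC f D + _ < GC f Q} ≤ _ at key
  linarith
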